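/- arXiv:2410.17755 — 3 statements merged into one kernel-verified Lean document; each statement's English description precedes it below -/
import Mathlib

section
/- Let G be a group, μ : G → ℚˣ a group homomorphism, and suppose there exists a central element g₀ ∈ G with μ(g₀) = 4. Let d ≥ 1 and let B be a symmetric 2d × 2d matrix over ℚ. Suppose f : M_{2d,1}(ℚ) × G → ℚ satisfies: (1) f(0, g·h) = μ(g)·f(0, h) + f(0, g) for all g, h ∈ G; (2) f(v, h) = f(0, h) + f(v, 1) for all v and all h ∈ G; (3) f(w + v, 1) = f(w, 1) + vᵀBw + f(v, 1) for all v, w; and suppose there is a polynomial P in 2d variables with rational coefficients such that f(v, 1) = P(v) for all v. Then there exist z ∈ ℚ and a row vector m ∈ M_{1,2d}(ℚ) such that f(v, g) = (1/2)·vᵀBv + m·v + (μ(g) − 1)·z for all v ∈ M_{2d,1}(ℚ) and g ∈ G. -/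
open Matrix

/-- An additive function on rational column vectors is multiplication by a row vector. -/
theorem exists_row_vector_of_additive {n : Type*} [Fintype n]
    (φ : Matrix n (Fin 1) ℚ →+ ℚ) :
    ∃ m : Matrix (Fin 1) n ℚ, ∀ v, φ v = (m * v) 0 0 := by
  classical
  refine ⟨Matrix.of fun _ i => φ (Matrix.single i 0 1), fun v => ?_⟩
  have hv : v = ∑ i, v i 0 • Matrix.single i 0 (1 : ℚ) := by
    conv_lhs => rw [Matrix.matrix_eq_sum_single v]
    simp
  conv_lhs => rw [hv]
  rw [map_sum, Matrix.mul_apply]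
  refine Finset.sum_congr rfl fun i _ => ?_
  rw [map_rat_smul, smul_eq_mul, mul_comm, Matrix.of_apply]

/-- The bilinear form attached to a symmetric matrix is symmetric. -/
theorem transpose_mul_mul_comm {n : Type*} [Fintype n] {B : Matrix n n ℚ} (hB : Bᵀ = B)
    (v w : Matrix n (Fin 1) ℚ) : (vᵀ * B * w) 0 0 = (wᵀ * B * v) 0 0 := by
  have h : (vᵀ * B * w)ᵀ = wᵀ * B * v := by
    rw [Matrix.transpose_mul, Matrix.transpose_mul, hB, Matrix.transpose_transpose,
      Matrix.mul_assoc]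
  rw [← h, Matrix.transpose_apply]

/-- The functional-equation lemma (Lemma 4.2 of the paper): if `f` satisfies the three
equations coming from the group law of `P_T`, the matrix `B` is symmetric, `g₀` is
central with `μ g₀ = 4`, and `v ↦ f v 1` is polynomial, then
`f v g = (1/2)·vᵀBv + m·v + (μ g − 1)·z` for some `z ∈ ℚ` and row vector `m`. -/
theorem functional_equation_lemma
    {G : Type*} [Group G] (μ : G →* ℚˣ)
    (g₀ : G) (hcentral : ∀ g : G, g₀ * g = g * g₀) (hμ : (μ g₀ : ℚ) = 4)
    (d : ℕ) (hd : 1 ≤ d)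
    (B : Matrix (Fin (2*d)) (Fin (2*d)) ℚ) (hB : Bᵀ = B)
    (f : Matrix (Fin (2*d)) (Fin 1) ℚ → G → ℚ)
    (h1 : ∀ g h : G, f 0 (g * h) = (μ g : ℚ) * f 0 h + f 0 g)
    (h2 : ∀ (v : Matrix (Fin (2*d)) (Fin 1) ℚ) (h : G), f v h = f 0 h + f v 1)
    (h3 : ∀ v w : Matrix (Fin (2*d)) (Fin 1) ℚ,
      f (w + v) 1 = f w 1 + (vᵀ * B * w) 0 0 + f v 1)
    (hpoly : ∃ P : MvPolynomial (Fin (2*d)) ℚ,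
      ∀ v : Matrix (Fin (2*d)) (Fin 1) ℚ,
        f v 1 = MvPolynomial.eval (fun i => v i 0) P) :
    ∃ (z : ℚ) (m : Matrix (Fin 1) (Fin (2*d)) ℚ),
      ∀ (v : Matrix (Fin (2*d)) (Fin 1) ℚ) (g : G),
        f v g = (1/2) * (vᵀ * B * v) 0 0 + (m * v) 0 0 + ((μ g : ℚ) - 1) * z := by
  have h_zero : ∀ g, f 0 g = ((μ g : ℚ) - 1) * (f 0 g₀ / 3) := by
    intro g
    have e₁ := h1 g₀ g
    have e₂ := h1 g g₀
    rw [hcentral g, e₂, hμ] at e₁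
    linarith
  let φ : Matrix (Fin (2*d)) (Fin 1) ℚ →+ ℚ :=
    AddMonoidHom.mk' (fun v => f v 1 - (1/2) * (vᵀ * B * v) 0 0) fun w v => by
      have h := h3 v w
      have hs := transpose_mul_mul_comm hB v w
      simp only [Matrix.transpose_add, Matrix.add_mul, Matrix.mul_add, Matrix.add_apply]
      linarith
  obtain ⟨m, hm⟩ := exists_row_vector_of_additive φ
  refine ⟨f 0 g₀ / 3, m, fun v g => ?_⟩
  have hv : f v 1 - (1/2) * (vᵀ * B * v) 0 0 = (m * v) 0 0 := hm v
  rw [h2, h_zero g]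
  linarith
end

section
/- Let R be a commutative ring, d, N ≥ 1, α ∈ M_{N,2d}(R), β ∈ M_{2d,N}(R) matrices with βα symmetric (i.e. (βα)ᵀ = βα). Let g ∈ GL_N(R) and μ ∈ Rˣ, and suppose that for every column vector w ∈ M_{2d,1}(R) there exists u ∈ M_{2d,1}(R) with αu = g·αw and uᵀβ = μ·wᵀβ·g⁻¹. Then for all v, w ∈ M_{2d,1}(R) one has the scalar identity μ·wᵀβ·g⁻¹·αv = vᵀβ·g·αw. -/
open Matrix

/-- If `βα` is symmetric and the pair `(g, μ)` stabilizes the submodule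
`Λ_R = {(αv, vᵀβ)}` (expressed by the hypothesis `hstab`), then
`μ·wᵀβ·g⁻¹·αv = vᵀβ·g·αw` for all columns `v, w`. -/
theorem ribet_stabilizer_scalar_identity
    {R : Type*} [CommRing R] (d N : ℕ) (hd : 1 ≤ d) (hN : 1 ≤ N)
    (α : Matrix (Fin N) (Fin (2*d)) R) (β : Matrix (Fin (2*d)) (Fin N) R)
    (hβα : (β * α)ᵀ = β * α)
    (g : GL (Fin N) R) (μ : Rˣ)
    (hstab : ∀ w : Matrix (Fin (2*d)) (Fin 1) R,
      ∃ u : Matrix (Fin (2*d)) (Fin 1) R,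
        α * u = (g : Matrix (Fin N) (Fin N) R) * (α * w) ∧
          uᵀ * β = (μ : R) • (wᵀ * β * ((g⁻¹ : GL (Fin N) R) : Matrix (Fin N) (Fin N) R))) :
    ∀ v w : Matrix (Fin (2*d)) (Fin 1) R,
      (μ : R) * (wᵀ * β * ((g⁻¹ : GL (Fin N) R) : Matrix (Fin N) (Fin N) R) * α * v) 0 0 =
        (vᵀ * β * (g : Matrix (Fin N) (Fin N) R) * α * w) 0 0 := by
  intro v w
  obtain ⟨u, hu, hw⟩ := hstab w
  have hsymm : (uᵀ * (β * α) * v)ᵀ = vᵀ * (β * α) * u := by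
    rw [transpose_mul, transpose_mul, hβα, transpose_transpose, ← Matrix.mul_assoc]
  calc (μ : R) * (wᵀ * β * ((g⁻¹ : GL (Fin N) R) : Matrix (Fin N) (Fin N) R) * α * v) 0 0
      = (uᵀ * (β * α) * v) 0 0 := by
        rw [← Matrix.mul_assoc uᵀ, hw, Matrix.smul_mul, Matrix.smul_mul, Matrix.smul_apply,
          smul_eq_mul]
    _ = (vᵀ * (β * α) * u) 0 0 := by rw [← hsymm, transpose_apply]
    _ = (vᵀ * β * (g : Matrix (Fin N) (Fin N) R) * α * w) 0 0 := by
        simp only [Matrix.mul_assoc, hu]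
end

section
/- Let R be a commutative ring in which 2 is a unit, d, N ≥ 1, α ∈ M_{N,2d}(R), β ∈ M_{2d,N}(R) with βα symmetric. Let g ∈ GL_N(R) and μ ∈ Rˣ, and suppose that for every w ∈ M_{2d,1}(R) there exists u with αu = g·αw and uᵀβ = μ·wᵀβ·g⁻¹. Then for x ∈ M_{1,N}(R), y ∈ M_{N,1}(R), and z ∈ R, the following are equivalent: (a) for all w ∈ M_{2d,1}(R) and all n ∈ R, there exists u ∈ M_{2d,1}(R) with αu = g·αw + n·y and uᵀβ = n·x·g⁻¹ + μ·wᵀβ·g⁻¹, and moreover x·αw + 2nz = (n·x·g⁻¹ + μ·wᵀβ·g⁻¹)·y as scalars; (b) there exists v ∈ M_{2d,1}(R) with y = αv, x = vᵀβg, and z = (1/2)·vᵀβαv. -/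
open Matrix

/-- A symmetric matrix `S` gives a symmetric pairing `vᵀ S u` of column vectors. -/
theorem Matrix.transpose_mul_mul_apply_comm_of_isSymm {m R : Type*} [Fintype m] [CommRing R]
    {S : Matrix m m R} (hS : S.IsSymm) (u v : Matrix m (Fin 1) R) :
    (vᵀ * S * u) 0 0 = (uᵀ * S * v) 0 0 := by
  rw [← transpose_apply (vᵀ * S * u)]
  simp only [transpose_mul, transpose_transpose, hS.eq, Matrix.mul_assoc]

/-- Lemma 3.4 of the paper, matrix-theoretically: given `(g, μ)` stabilizing
`Λ_R = {(αv, vᵀβ)}` and `βα` symmetric, the block matrix `[[μ, x, z],[0, g, y],[0, 0, 1]]`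
fixes the tensor `Θ_Λ` (condition (a)) iff `y = αv`, `x = vᵀβg` and `z = ½·vᵀβαv`
for some column `v` (condition (b)). -/
theorem ribet_stabilizer_normal_form
    {R : Type*} [CommRing R] [Invertible (2 : R)]
    (d N : ℕ) (hd : 1 ≤ d) (hN : 1 ≤ N)
    (α : Matrix (Fin N) (Fin (2*d)) R) (β : Matrix (Fin (2*d)) (Fin N) R)
    (hβα : (β * α)ᵀ = β * α)
    (g : GL (Fin N) R) (μ : Rˣ)
    (hstab : ∀ w : Matrix (Fin (2*d)) (Fin 1) R,
      ∃ u : Matrix (Fin (2*d)) (Fin 1) R,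
        α * u = (g : Matrix (Fin N) (Fin N) R) * (α * w) ∧
          uᵀ * β = (μ : R) • (wᵀ * β * ((g⁻¹ : GL (Fin N) R) : Matrix (Fin N) (Fin N) R)))
    (x : Matrix (Fin 1) (Fin N) R) (y : Matrix (Fin N) (Fin 1) R) (z : R) :
    (∀ (w : Matrix (Fin (2*d)) (Fin 1) R) (n : R),
      (∃ u : Matrix (Fin (2*d)) (Fin 1) R,
        α * u = (g : Matrix (Fin N) (Fin N) R) * (α * w) + n • y ∧
          uᵀ * β = n • (x * ((g⁻¹ : GL (Fin N) R) : Matrix (Fin N) (Fin N) R)) +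
            (μ : R) • (wᵀ * β * ((g⁻¹ : GL (Fin N) R) : Matrix (Fin N) (Fin N) R))) ∧
      (x * (α * w)) 0 0 + 2 * n * z =
        ((n • (x * ((g⁻¹ : GL (Fin N) R) : Matrix (Fin N) (Fin N) R)) +
          (μ : R) • (wᵀ * β * ((g⁻¹ : GL (Fin N) R) : Matrix (Fin N) (Fin N) R))) * y) 0 0)
    ↔ (∃ v : Matrix (Fin (2*d)) (Fin 1) R,
        y = α * v ∧ x = vᵀ * β * (g : Matrix (Fin N) (Fin N) R) ∧
          z = ⅟(2 : R) * (vᵀ * β * α * v) 0 0) := by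
  constructor
  · intro h
    obtain ⟨⟨u, hu, hu'⟩, hz⟩ := h 0 1
    simp only [Matrix.mul_zero, zero_add, one_smul, transpose_zero, Matrix.zero_mul, smul_zero,
      add_zero, Matrix.zero_apply, mul_one] at hu hu' hz
    refine ⟨u, hu.symm, ?_, ?_⟩
    · rw [hu', Matrix.mul_assoc, Units.inv_mul, Matrix.mul_one]
    · rw [Matrix.mul_assoc (uᵀ * β), hu, hu', ← hz, invOf_mul_cancel_left]
  · rintro ⟨v, rfl, rfl, rfl⟩ w n
    obtain ⟨u, hu, hu'⟩ := hstab w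
    have hv : vᵀ * β * (g : Matrix (Fin N) (Fin N) R) *
        ((g⁻¹ : GL (Fin N) R) : Matrix (Fin N) (Fin N) R) = vᵀ * β := by
      rw [Matrix.mul_assoc, Units.mul_inv, Matrix.mul_one]
    rw [hv, ← hu']
    refine ⟨⟨u + n • v, ?_, ?_⟩, ?_⟩
    · rw [Matrix.mul_add, Matrix.mul_smul, hu]
    · rw [transpose_add, transpose_smul, Matrix.add_mul, Matrix.smul_mul, add_comm]
    · have hsymm := transpose_mul_mul_apply_comm_of_isSymm (S := β * α) hβα u v
      rw [Matrix.mul_assoc (vᵀ * β), ← hu, Matrix.add_mul, Matrix.smul_mul, Matrix.add_apply,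
        Matrix.smul_apply, smul_eq_mul]
      simp only [Matrix.mul_assoc] at hsymm ⊢
      rw [hsymm, mul_right_comm, mul_invOf_cancel_left, add_comm, mul_comm]
end
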